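/- Let A ∈ ℝ^{m×n}, b ∈ ℝ^m, ζ > 0, μ := λ_min(AᵀA), L_g := λ_max(AᵀA), and suppose ρ > (−μ + √(μ² + 8L_g²))/2. Let {(x_k, y_k, λ_k)}_{k≥0} be sequences in ℝⁿ satisfying for every k: x_{k+1} is a global minimizer of x ↦ Φ(x) + (ρ/2)‖x − y_k + λ_k/ρ‖_2²; y_{k+1} is the minimizer of y ↦ g(y) + (ρ/2)‖y − x_{k+1} − λ_k/ρ‖_2²; λ_{k+1} = λ_k + ρ(x_{k+1} − y_{k+1}); and λ_k = Aᵀ(Ay_k − b). If the sequence {x_k} is bounded, then: (i) {y_k} and {λ_k} are bounded; (ii) the sequence {(x_k, y_k, λ_k)} has at least one accumulation point; (iii) ‖x_{k+1} − x_k‖_2 → 0, ‖y_{k+1} − y_k‖_2 → 0, and ‖λ_{k+1} − λ_k‖_2 → 0 as k → ∞. -/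

import Mathlib

open Filter

/-- The set of (real) eigenvalues of a square matrix `M`. -/
def eigSet {n : ℕ} (M : Matrix (Fin n) (Fin n) ℝ) : Set ℝ :=
  {t : ℝ | ∃ v : Fin n → ℝ, v ≠ 0 ∧ M.mulVec v = t • v}

/-- `Φ(x) = ζ ‖x‖_{1/2}^{1/2}/‖x‖_2^{1/2}` for `x ≠ 0`, and `Φ(0) = ζ`. -/
noncomputable def Phi {n : ℕ} (ζ : ℝ) (x : Fin n → ℝ) : ℝ :=
  if x = 0 then ζ
  else ζ * (∑ i, |x i| ^ ((1 : ℝ)/2)) / (∑ i, (x i) ^ 2) ^ ((1 : ℝ)/4)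

/-- `g(y) = ½‖Ay − b‖₂²`. -/
noncomputable def gobj {m n : ℕ} (A : Matrix (Fin m) (Fin n) ℝ) (b : Fin m → ℝ)
    (y : Fin n → ℝ) : ℝ :=
  (1/2) * ∑ j, (A.mulVec y j - b j) ^ 2

open Matrix in
lemma aux_low {n : ℕ} (M : Matrix (Fin n) (Fin n) ℝ) (hM : M.IsHermitian) (μ : ℝ)
    (h : ∀ t ∈ eigSet M, μ ≤ t) (v : Fin n → ℝ) : μ * (v ⬝ᵥ v) ≤ v ⬝ᵥ (M *ᵥ v) := by
  have hH : (M - μ • (1 : Matrix (Fin n) (Fin n) ℝ)).IsHermitian := by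
    apply hM.sub
    ext i j
    simp [Matrix.one_apply, eq_comm]
  have hP : (M - μ • (1 : Matrix (Fin n) (Fin n) ℝ)).PosSemidef := by
    rw [hH.posSemidef_iff_eigenvalues_nonneg]
    intro i
    have h1 := hH.mulVec_eigenvectorBasis i
    have h2 : (⇑(hH.eigenvectorBasis i) : Fin n → ℝ) ≠ 0 := by
      intro h0
      apply hH.eigenvectorBasis.orthonormal.ne_zero i
      ext j
      exact congrFun h0 j
    have h3 := h (hH.eigenvalues i + μ) ⟨_, h2, by
      rw [Matrix.sub_mulVec, Matrix.smul_mulVec, Matrix.one_mulVec, sub_eq_iff_eq_add] at h1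
      rw [h1, add_smul]⟩
    simp only [Pi.zero_apply]
    linarith
  have := hP.dotProduct_mulVec_nonneg v
  rw [Matrix.sub_mulVec, Matrix.smul_mulVec, Matrix.one_mulVec, dotProduct_sub,
    dotProduct_smul] at this
  simp at this
  linarith

open Matrix in
lemma aux_up {n : ℕ} (M : Matrix (Fin n) (Fin n) ℝ) (hM : M.IsHermitian) (L : ℝ)
    (h : ∀ t ∈ eigSet M, t ≤ L) (v : Fin n → ℝ) : v ⬝ᵥ (M *ᵥ v) ≤ L * (v ⬝ᵥ v) := by
  have := aux_low (-M) hM.neg (-L) (by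
    rintro t ⟨w, hw, hw2⟩
    have := h (-t) ⟨w, hw, by rw [neg_smul, ← hw2, Matrix.neg_mulVec, neg_neg]⟩
    linarith) v
  rw [Matrix.neg_mulVec, dotProduct_neg] at this
  linarith

open Matrix in
lemma aux_adj {m n : ℕ} (A : Matrix (Fin m) (Fin n) ℝ) (r : Fin m → ℝ) (d : Fin n → ℝ) :
    (A.transpose *ᵥ r) ⬝ᵥ d = r ⬝ᵥ (A *ᵥ d) := by
  rw [Matrix.dotProduct_mulVec, Matrix.mulVec_transpose]

open Matrix in
lemma aux_nonneg {n : ℕ} (v : Fin n → ℝ) : 0 ≤ v ⬝ᵥ v :=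
  Finset.sum_nonneg fun i _ => mul_self_nonneg (v i)

open Matrix in
lemma aux_sq {m n : ℕ} (A : Matrix (Fin m) (Fin n) ℝ) (L : ℝ) (hL0 : 0 ≤ L)
    (h : ∀ v, (A *ᵥ v) ⬝ᵥ (A *ᵥ v) ≤ L * (v ⬝ᵥ v)) (v : Fin n → ℝ) :
    (A.transpose *ᵥ (A *ᵥ v)) ⬝ᵥ (A.transpose *ᵥ (A *ᵥ v)) ≤ L ^ 2 * (v ⬝ᵥ v) := by
  rcases hL0.eq_or_lt with h0 | h0
  · have h1 := h v
    rw [← h0, zero_mul] at h1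
    have h2 : A *ᵥ v = 0 := dotProduct_self_eq_zero.1 (le_antisymm h1 (aux_nonneg _))
    simp [h2, ← h0]
  · set w := A.transpose *ᵥ (A *ᵥ v) with hw
    have e : w ⬝ᵥ w = (A *ᵥ v) ⬝ᵥ (A *ᵥ w) := by
      conv_lhs => rw [hw]
      rw [aux_adj]
    have h1 := aux_nonneg (L • (A *ᵥ v) - A *ᵥ w)
    have h2 := h v
    have h3 := h w
    simp only [dotProduct_sub, sub_dotProduct, smul_dotProduct, dotProduct_smul, smul_eq_mul,
      dotProduct_comm (A *ᵥ w) (A *ᵥ v), ← e] at h1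
    have h4 : L * (w ⬝ᵥ w) ≤ L * (L ^ 2 * (v ⬝ᵥ v)) := by
      nlinarith [mul_le_mul_of_nonneg_left h2 (mul_nonneg hL0 hL0)]
    exact le_of_mul_le_mul_left h4 h0

open Matrix in
lemma aux_g {m n : ℕ} (A : Matrix (Fin m) (Fin n) ℝ) (b : Fin m → ℝ) (y z : Fin n → ℝ) :
    gobj A b z = gobj A b y + (A.transpose *ᵥ (A *ᵥ y - b)) ⬝ᵥ (z - y)
      + (1/2) * ((A *ᵥ (z - y)) ⬝ᵥ (A *ᵥ (z - y))) := by
  rw [aux_adj, Matrix.mulVec_sub]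
  simp only [gobj, dotProduct, Finset.mul_sum, ← Finset.sum_add_distrib]
  refine Finset.sum_congr rfl fun i _ => ?_
  simp only [Pi.sub_apply]
  ring

open Matrix in
lemma aux_x {n : ℕ} (ρ : ℝ) (hρ : 0 < ρ) (x y l : Fin n → ℝ) :
    (ρ/2) * ∑ i, (x i - y i + l i / ρ) ^ 2
      = l ⬝ᵥ (x - y) + (ρ/2) * ((x - y) ⬝ᵥ (x - y)) + (1/(2*ρ)) * (l ⬝ᵥ l) := by
  simp only [dotProduct, Finset.mul_sum, ← Finset.sum_add_distrib]
  refine Finset.sum_congr rfl fun i _ => ?_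
  simp only [Pi.sub_apply]
  field_simp
  ring

lemma aux_Phi {n : ℕ} (ζ : ℝ) (hζ : 0 < ζ) (x : Fin n → ℝ) : 0 ≤ Phi ζ x := by
  unfold Phi
  split_ifs
  · exact hζ.le
  · positivity

open Matrix in
lemma aux_tend {n : ℕ} (d : ℕ → Fin n → ℝ)
    (h : Tendsto (fun k => d k ⬝ᵥ d k) atTop (nhds 0)) : Tendsto d atTop (nhds 0) := by
  rw [tendsto_pi_nhds]
  intro i
  have h2 : Tendsto (fun k => (d k i) ^ 2) atTop (nhds 0) := by
    refine squeeze_zero (fun k => sq_nonneg _) (fun k => ?_) h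
    rw [pow_two]
    exact Finset.single_le_sum (f := fun j => d k j * d k j)
      (fun j _ => mul_self_nonneg _) (Finset.mem_univ i)
  have h3 := h2.sqrt
  simp only [Real.sqrt_sq_eq_abs, Real.sqrt_zero] at h3
  exact (tendsto_zero_iff_abs_tendsto_zero _).2 h3

open Matrix in
lemma aux_desc {n : ℕ} (ρ μ L gy gy' P q : ℝ) (hρ : 0 < ρ) (x y y' l l' w : Fin n → ℝ)
    (hl : l' = l + ρ • (x - y')) (hw : l - l' = w)
    (hg : gy = gy' + l' ⬝ᵥ (y - y') + (1/2) * q)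
    (hq : μ * ((y - y') ⬝ᵥ (y - y')) ≤ q)
    (hw2 : w ⬝ᵥ w ≤ L ^ 2 * ((y - y') ⬝ᵥ (y - y'))) :
    P + gy' + l' ⬝ᵥ (x - y') + (ρ/2) * ((x - y') ⬝ᵥ (x - y'))
      + ((μ + ρ)/2 - L^2/ρ) * ((y - y') ⬝ᵥ (y - y'))
    ≤ P + gy + l ⬝ᵥ (x - y) + (ρ/2) * ((x - y) ⬝ᵥ (x - y)) := by
  obtain ⟨d, hd⟩ : ∃ d, d = y - y' := ⟨_, rfl⟩
  obtain ⟨e, he⟩ : ∃ e, e = x - y' := ⟨_, rfl⟩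
  have h1 : x - y = e - d := by rw [hd, he]; abel
  rw [← he] at hl
  have h2 : l = l' - ρ • e := by rw [hl]; abel
  have h3 : w = -(ρ • e) := by rw [← hw, h2]; abel
  rw [h1, ← he, ← hd, hg, ← hd, h2]
  rw [← hd] at hq hw2
  rw [h3] at hw2
  simp only [dotProduct_sub, sub_dotProduct, smul_dotProduct, dotProduct_smul, smul_eq_mul,
    neg_dotProduct, dotProduct_neg, neg_neg, dotProduct_comm d e] at hw2 ⊢
  have h4 : ρ * (e ⬝ᵥ e) ≤ L^2/ρ * (d ⬝ᵥ d) := by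
    rw [div_mul_eq_mul_div, le_div_iff₀ hρ]
    linarith
  nlinarith

open scoped Matrix

/-- Subsequential convergence of the ADMM iterates: with
`μ = λ_min(AᵀA)`, `L_g = λ_max(AᵀA)`, `ρ > (−μ + √(μ² + 8L_g²))/2`, the ADMM update
relations, `λ_k = Aᵀ(Ay_k − b)`, and `{x_k}` bounded, one has:
(i) `{y_k}` and `{λ_k}` are bounded; (ii) `{(x_k, y_k, λ_k)}` has an accumulation
point; (iii) successive differences of all three sequences tend to zero. -/
theorem admm_subsequential_convergence (m n : ℕ) (A : Matrix (Fin m) (Fin n) ℝ)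
    (b : Fin m → ℝ) (ζ ρ μ L : ℝ) (hζ : 0 < ζ)
    (hμ : IsLeast (eigSet (A.transpose * A)) μ)
    (hL : IsGreatest (eigSet (A.transpose * A)) L)
    (hρ : ρ > (-μ + Real.sqrt (μ ^ 2 + 8 * L ^ 2)) / 2)
    (x y lam : ℕ → Fin n → ℝ)
    (hxp : ∀ k, ∀ x' : Fin n → ℝ,
      Phi ζ (x (k+1)) + (ρ/2) * ∑ i, (x (k+1) i - y k i + lam k i / ρ) ^ 2
        ≤ Phi ζ x' + (ρ/2) * ∑ i, (x' i - y k i + lam k i / ρ) ^ 2)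
    (hyp : ∀ k, ∀ y' : Fin n → ℝ,
      gobj A b (y (k+1)) + (ρ/2) * ∑ i, (y (k+1) i - x (k+1) i - lam k i / ρ) ^ 2
        ≤ gobj A b y' + (ρ/2) * ∑ i, (y' i - x (k+1) i - lam k i / ρ) ^ 2)
    (hlamp : ∀ k, lam (k+1) = lam k + ρ • (x (k+1) - y (k+1)))
    (hlam : ∀ k, lam k = A.transpose.mulVec (A.mulVec (y k) - b))
    (hxbd : Bornology.IsBounded (Set.range x)) :
    (Bornology.IsBounded (Set.range y) ∧ Bornology.IsBounded (Set.range lam)) ∧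
      (∃ (pt : (Fin n → ℝ) × (Fin n → ℝ) × (Fin n → ℝ)) (φ : ℕ → ℕ), StrictMono φ ∧
        Tendsto (fun k => (x (φ k), y (φ k), lam (φ k))) atTop (nhds pt)) ∧
      (Tendsto (fun k => x (k+1) - x k) atTop (nhds 0) ∧
        Tendsto (fun k => y (k+1) - y k) atTop (nhds 0) ∧
        Tendsto (fun k => lam (k+1) - lam k) atTop (nhds 0)) := by
  have hH : (A.transpose * A).IsHermitian := by
    have := Matrix.isHermitian_conjTranspose_mul_self A
    rwa [Matrix.conjTranspose_eq_transpose_of_trivial] at this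
  have hMA : ∀ v, v ⬝ᵥ ((A.transpose * A) *ᵥ v) = (A *ᵥ v) ⬝ᵥ (A *ᵥ v) := fun v => by
    rw [← Matrix.mulVec_mulVec, dotProduct_comm, aux_adj]
  have hlow : ∀ v, μ * (v ⬝ᵥ v) ≤ (A *ᵥ v) ⬝ᵥ (A *ᵥ v) := fun v => by
    rw [← hMA]; exact aux_low _ hH μ (fun t ht => hμ.2 ht) v
  have hup : ∀ v, (A *ᵥ v) ⬝ᵥ (A *ᵥ v) ≤ L * (v ⬝ᵥ v) := fun v => by
    rw [← hMA]; exact aux_up _ hH L (fun t ht => hL.2 ht) v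
  have hμL : μ ≤ L := hμ.2 hL.1
  have hμ0 : 0 ≤ μ := by
    obtain ⟨v, hv, hv2⟩ := hμ.1
    have h1 := hMA v
    rw [hv2, dotProduct_smul, smul_eq_mul] at h1
    have h2 : 0 < v ⬝ᵥ v := lt_of_le_of_ne (aux_nonneg v)
      fun h => hv (dotProduct_self_eq_zero.1 h.symm)
    have h3 := aux_nonneg (A *ᵥ v)
    by_contra hc
    push Not at hc
    nlinarith
  have hL0 : 0 ≤ L := hμ0.trans hμL
  have hsqrt : 0 ≤ Real.sqrt (μ ^ 2 + 8 * L ^ 2) := Real.sqrt_nonneg _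
  have hsq : Real.sqrt (μ ^ 2 + 8 * L ^ 2) ^ 2 = μ ^ 2 + 8 * L ^ 2 := Real.sq_sqrt (by positivity)
  have hsμ : μ ≤ Real.sqrt (μ ^ 2 + 8 * L ^ 2) := Real.le_sqrt_of_sq_le (by nlinarith)
  have hρ0 : 0 < ρ := by linarith
  have hquad : 0 < ρ ^ 2 + μ * ρ - 2 * L ^ 2 := by nlinarith
  have hρL : L ≤ ρ := by
    by_contra hc
    push Not at hc
    nlinarith
  have hc : 0 < (μ + ρ)/2 - L^2/ρ := by
    have : (μ + ρ)/2 - L^2/ρ = (ρ ^ 2 + μ * ρ - 2 * L ^ 2) / (2 * ρ) := by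
      field_simp
      ring
    rw [this]
    positivity
  set c := (μ + ρ)/2 - L^2/ρ with hcdef
  have hdiff : ∀ k, lam k - lam (k+1) = A.transpose *ᵥ (A *ᵥ (y k - y (k+1))) := fun k => by
    rw [hlam k, hlam (k+1), ← Matrix.mulVec_sub, Matrix.mulVec_sub A]
    congr 1
    abel
  obtain ⟨F, hF⟩ : ∃ F : ℕ → ℝ, F = fun k => Phi ζ (x k) + gobj A b (y k) + lam k ⬝ᵥ (x k - y k)
    + (ρ/2) * ((x k - y k) ⬝ᵥ (x k - y k)) := ⟨_, rfl⟩
  have hdesc : ∀ k, F (k+1) + c * ((y k - y (k+1)) ⬝ᵥ (y k - y (k+1))) ≤ F k := fun k => by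
    have h1 := hxp k (x k)
    rw [aux_x ρ hρ0, aux_x ρ hρ0] at h1
    have h2 := aux_desc ρ μ L (gobj A b (y k)) (gobj A b (y (k+1))) (Phi ζ (x (k+1))) _ hρ0
      (x (k+1)) (y k) (y (k+1)) (lam k) (lam (k+1)) _ (hlamp k) (hdiff k)
      (by rw [hlam (k+1)]; exact aux_g A b (y (k+1)) (y k)) (hlow _) (aux_sq A L hL0 hup _)
    rw [← hcdef] at h2
    simp only [hF]
    linarith
  have hF0 : ∀ k, 0 ≤ F k := fun k => by
    have h1 := aux_g A b (y k) (x k)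
    rw [← hlam k] at h1
    have h2 := hup (x k - y k)
    have h3 := aux_Phi ζ hζ (x k)
    have h4 : 0 ≤ gobj A b (x k) := by unfold gobj; positivity
    have h5 := aux_nonneg (x k - y k)
    simp only [hF]
    nlinarith [mul_le_mul_of_nonneg_right hρL h5]
  have hanti : Antitone F := antitone_nat_of_succ_le fun k => by
    have := mul_nonneg hc.le (aux_nonneg (y k - y (k+1)))
    linarith [hdesc k]
  have hlim := tendsto_atTop_ciInf hanti ⟨0, by rintro _ ⟨k, rfl⟩; exact hF0 k⟩
  have hFd : Tendsto (fun k => (F k - F (k+1)) / c) atTop (nhds 0) := by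
    have := (hlim.sub ((tendsto_add_atTop_iff_nat 1).2 hlim)).div_const c
    simpa using this
  have hy' : Tendsto (fun k => y k - y (k+1)) atTop (nhds 0) := by
    apply aux_tend
    refine squeeze_zero (fun k => aux_nonneg _) (fun k => ?_) hFd
    rw [le_div_iff₀ hc]
    linarith [hdesc k]
  have hl' : Tendsto (fun k => lam k - lam (k+1)) atTop (nhds 0) := by
    simp only [hdiff]
    have hcont : Continuous fun v : Fin n → ℝ => A.transpose *ᵥ (A *ᵥ v) := by fun_prop
    have := (hcont.tendsto 0).comp hy'
    simpa [Function.comp_def] using this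
  have hy : Tendsto (fun k => y (k+1) - y k) atTop (nhds 0) := by
    simpa using hy'.neg
  have hl : Tendsto (fun k => lam (k+1) - lam k) atTop (nhds 0) := by
    simpa using hl'.neg
  have hxy1 : Tendsto (fun k => x (k+1) - y (k+1)) atTop (nhds 0) := by
    have h1 : ∀ k, x (k+1) - y (k+1) = ρ⁻¹ • (lam (k+1) - lam k) := fun k => by
      rw [hlamp k, add_sub_cancel_left, smul_smul, inv_mul_cancel₀ hρ0.ne', one_smul]
    simp only [h1]
    simpa using hl.const_smul ρ⁻¹
  have hxy : Tendsto (fun k => x k - y k) atTop (nhds 0) :=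
    (tendsto_add_atTop_iff_nat (f := fun k => x k - y k) 1).1 hxy1
  have hx : Tendsto (fun k => x (k+1) - x k) atTop (nhds 0) := by
    have := (hxy1.add hy).sub hxy
    simp only [add_zero, sub_zero] at this
    refine this.congr fun k => ?_
    abel
  have hyb : Bornology.IsBounded (Set.range y) := by
    refine (hxbd.sub (Metric.isBounded_range_of_tendsto _ hxy)).subset ?_
    rintro _ ⟨k, rfl⟩
    exact ⟨x k, ⟨k, rfl⟩, x k - y k, ⟨k, rfl⟩, by simp⟩
  have hlb : Bornology.IsBounded (Set.range lam) := by
    have hcont : Continuous fun v : Fin n → ℝ => A.transpose *ᵥ (A *ᵥ v - b) := by fun_prop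
    refine ((hyb.isCompact_closure.image hcont).isBounded).subset ?_
    rintro _ ⟨k, rfl⟩
    exact ⟨y k, subset_closure ⟨k, rfl⟩, (hlam k).symm⟩
  refine ⟨⟨hyb, hlb⟩, ?_, hx, hy, hl⟩
  obtain ⟨pt, -, φ, hφ, hφ2⟩ := tendsto_subseq_of_bounded (hxbd.prod (hyb.prod hlb))
    (x := fun k => (x k, y k, lam k)) (fun k => ⟨⟨k, rfl⟩, ⟨k, rfl⟩, ⟨k, rfl⟩⟩)
  exact ⟨pt, φ, hφ, hφ2⟩
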